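/- Let p(n) = ∑_{i=0}^k a_i n^i be a polynomial with real coefficients such that at least one of the coefficients a_1, …, a_k of the non-constant terms is irrational, and let d be any real number. Then the lower box (Minkowski) dimension of the set {frac(p(n) + 2^n·d) : n ≥ 1} ⊆ [0,1] equals 1. -/

import Mathlib

open MeasureTheory Filter

/-- `coverNum F r` is the minimal number of closed intervals of length `r`
(i.e. closed balls of radius `r/2`) needed to cover `F ⊆ ℝ`. -/
noncomputable def coverNum (F : Set ℝ) (r : ℝ) : ℕ :=
  sInf {n : ℕ | ∃ s : Finset ℝ, s.card = n ∧ F ⊆ ⋃ x ∈ s, Metric.closedBall x (r / 2)}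

/-- The lower box (Minkowski) dimension of a set `F ⊆ ℝ`:
`liminf_{r → 0⁺} (− log N(F,r) / log r)`. -/
noncomputable def lowerBoxDim (F : Set ℝ) : ℝ :=
  liminf (fun r : ℝ => -Real.log (coverNum F r) / Real.log r) (nhdsWithin 0 (Set.Ioi 0))

/-- A shift-invariant mean on bounded real sequences, extended linearly to all sequences. -/
structure IsShiftMean (M : (ℕ → ℝ) →ₗ[ℝ] ℝ) : Prop where
  one : M (fun _ => 1) = 1
  nonneg : ∀ f : ℕ → ℝ, (∃ C, ∀ n, |f n| ≤ C) → (∀ n, 0 ≤ f n) → 0 ≤ M f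
  shift : ∀ f : ℕ → ℝ, (∃ C, ∀ n, |f n| ≤ C) → M (fun n => f (n + 1)) = M f

/-- The average of the first `N + 1` terms of a sequence. -/
noncomputable def cesaroAvg (f : ℕ → ℝ) (N : ℕ) : ℝ :=
  (∑ i ∈ Finset.range (N + 1), f i) / (N + 1)

theorem abs_cesaroAvg_le {f : ℕ → ℝ} {C : ℝ} (hf : ∀ n, |f n| ≤ C) (N : ℕ) :
    |cesaroAvg f N| ≤ C := by
  have hN : (0 : ℝ) < N + 1 := by positivity
  rw [cesaroAvg, abs_div, abs_of_pos hN, div_le_iff₀ hN]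
  calc |∑ i ∈ Finset.range (N + 1), f i| ≤ ∑ i ∈ Finset.range (N + 1), |f i| :=
        Finset.abs_sum_le_sum_abs _ _
    _ ≤ ∑ i ∈ Finset.range (N + 1), C := Finset.sum_le_sum fun i _ => hf i
    _ = C * (N + 1) := by simp [mul_comm]

theorem tendsto_cesaroAvg_hyperfilter {f : ℕ → ℝ} (hf : ∃ C, ∀ n, |f n| ≤ C) :
    Tendsto (cesaroAvg f) (hyperfilter ℕ)
      (nhds (limUnder (hyperfilter ℕ : Filter ℕ) (cesaroAvg f))) := by
  obtain ⟨C, hC⟩ := hf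
  apply tendsto_nhds_limUnder
  obtain ⟨x, -, hx⟩ := (isCompact_Icc (a := -C) (b := C)).ultrafilter_le_nhds
    ((hyperfilter ℕ).map (cesaroAvg f)) (by
      rw [le_principal_iff]
      exact mem_map.2 (univ_mem' fun N => abs_le.1 (abs_cesaroAvg_le hC N)))
  exact ⟨x, hx⟩

theorem exists_isShiftMean : ∃ M : (ℕ → ℝ) →ₗ[ℝ] ℝ, IsShiftMean M := by
  let V : Submodule ℝ (ℕ → ℝ) :=
    { carrier := {f | ∃ C, ∀ n, |f n| ≤ C}
      add_mem' := by
        rintro f g ⟨C, hC⟩ ⟨D, hD⟩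
        exact ⟨C + D, fun n => (abs_add_le _ _).trans (add_le_add (hC n) (hD n))⟩
      zero_mem' := ⟨0, by simp⟩
      smul_mem' := by
        rintro c f ⟨C, hC⟩
        refine ⟨|c| * C, fun n => ?_⟩
        simpa [abs_mul] using mul_le_mul_of_nonneg_left (hC n) (abs_nonneg c) }
  let M₀ : V →ₗ[ℝ] ℝ :=
    { toFun := fun f => limUnder (hyperfilter ℕ : Filter ℕ) (cesaroAvg f)
      map_add' := by
        rintro ⟨f, hf⟩ ⟨g, hg⟩
        refine tendsto_nhds_unique (tendsto_cesaroAvg_hyperfilter (V.add_mem hf hg)) ?_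
        refine ((tendsto_cesaroAvg_hyperfilter hf).add
          (tendsto_cesaroAvg_hyperfilter hg)).congr fun N => ?_
        simp [cesaroAvg, Finset.sum_add_distrib, add_div]
      map_smul' := by
        rintro c ⟨f, hf⟩
        refine tendsto_nhds_unique (tendsto_cesaroAvg_hyperfilter (V.smul_mem c hf)) ?_
        refine ((tendsto_cesaroAvg_hyperfilter hf).const_mul c).congr fun N => ?_
        simp [cesaroAvg, ← Finset.mul_sum, mul_div_assoc] }
  obtain ⟨M, hM⟩ := M₀.exists_extend
  have key : ∀ f : ℕ → ℝ, (∃ C, ∀ n, |f n| ≤ C) →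
      Tendsto (cesaroAvg f) (hyperfilter ℕ) (nhds (M f)) := by
    intro f hf
    have : M f = M₀ ⟨f, hf⟩ := by rw [← hM]; rfl
    rw [this]
    exact tendsto_cesaroAvg_hyperfilter hf
  refine ⟨M, ?_, ?_, ?_⟩
  · refine tendsto_nhds_unique (key _ ⟨1, by simp⟩) (tendsto_const_nhds.congr fun N => ?_)
    have hN : (N : ℝ) + 1 ≠ 0 := by positivity
    simp [cesaroAvg, hN]
  · intro f hf h0
    refine ge_of_tendsto' (key f hf) fun N => ?_
    exact div_nonneg (Finset.sum_nonneg fun i _ => h0 i) (by positivity)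
  · rintro f ⟨C, hC⟩
    have h1 := key (fun n => f (n + 1)) ⟨C, fun n => hC _⟩
    have h2 := key f ⟨C, hC⟩
    have h3 : Tendsto (fun N : ℕ => (f (N + 1) - f 0) / ((N : ℝ) + 1)) (hyperfilter ℕ)
        (nhds 0) := by
      refine Tendsto.mono_left ?_ (Nat.hyperfilter_le_atTop)
      have h4 : Tendsto (fun N : ℕ => (2 * C) * (1 / ((N : ℝ) + 1))) atTop (nhds 0) := by
        simpa using (tendsto_one_div_add_atTop_nhds_zero_nat (𝕜 := ℝ)).const_mul (2 * C)
      refine squeeze_zero_norm (fun N => ?_) h4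
      have hN : (0 : ℝ) < N + 1 := by positivity
      rw [Real.norm_eq_abs, abs_div, abs_of_pos hN, mul_one_div]
      gcongr
      have := abs_sub (f (N + 1)) (f 0)
      linarith [hC (N + 1), hC 0]
    refine tendsto_nhds_unique h1 ?_
    have h5 := h2.add h3
    rw [add_zero] at h5
    refine h5.congr fun N => ?_
    rw [cesaroAvg, cesaroAvg, ← add_div]
    congr 1
    have e1 := Finset.sum_range_succ f (N + 1)
    have e2 := Finset.sum_range_succ' f (N + 1)
    linarith

namespace IsShiftMean

variable {M : (ℕ → ℝ) →ₗ[ℝ] ℝ}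

theorem const (hM : IsShiftMean M) (c : ℝ) : M (fun _ => c) = c := by
  have : (fun _ : ℕ => c) = c • (fun _ : ℕ => (1 : ℝ)) := by ext; simp
  rw [this, map_smul, hM.one]; simp

theorem mono (hM : IsShiftMean M) {f g : ℕ → ℝ} (hf : ∃ C, ∀ n, |f n| ≤ C) (hg : ∃ C, ∀ n, |g n| ≤ C)
    (h : ∀ n, f n ≤ g n) : M f ≤ M g := by
  have := hM.nonneg (g - f) ?_ fun n => sub_nonneg.2 (h n)
  · rw [map_sub] at this; linarith
  · obtain ⟨C, hC⟩ := hf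
    obtain ⟨D, hD⟩ := hg
    exact ⟨D + C, fun n => (abs_sub _ _).trans (add_le_add (hD n) (hC n))⟩

theorem shift_add (hM : IsShiftMean M) {f : ℕ → ℝ} (hf : ∃ C, ∀ n, |f n| ≤ C) (t : ℕ) :
    M (fun n => f (n + t)) = M f := by
  induction t with
  | zero => rfl
  | succ t ih =>
    obtain ⟨C, hC⟩ := hf
    have := hM.shift (fun n => f (n + t)) ⟨C, fun n => hC _⟩
    rw [← ih, ← this]
    congr 1; ext n; congr 1; ring

theorem sq_le (hM : IsShiftMean M) {g : ℕ → ℝ} (hg : ∃ C, ∀ n, |g n| ≤ C) : M g ^ 2 ≤ M (fun n => g n ^ 2) := by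
  obtain ⟨C, hC⟩ := hg
  have h := hM.nonneg (fun n => (g n - M g) ^ 2) ⟨(C + |M g|) ^ 2, fun n => ?_⟩
    fun n => sq_nonneg _
  · have e : (fun n => (g n - M g) ^ 2) =
        (fun n => g n ^ 2) - (2 * M g) • g + (fun _ => M g ^ 2) := by
      ext n; simp; ring
    rw [e, map_add, map_sub, map_smul, hM.const, smul_eq_mul] at h
    nlinarith
  · rw [abs_pow]
    gcongr
    exact (abs_sub _ _).trans (by gcongr; exact hC n)

end IsShiftMean

theorem sq_sum_cos_le {ι : Type*} (s : Finset ι) (g : ι → ℝ) :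
    (∑ i ∈ s, Real.cos (g i)) ^ 2 ≤ ∑ i ∈ s, ∑ j ∈ s, Real.cos (g i - g j) := by
  have : ∑ i ∈ s, ∑ j ∈ s, Real.cos (g i - g j) =
      (∑ i ∈ s, Real.cos (g i)) ^ 2 + (∑ i ∈ s, Real.sin (g i)) ^ 2 := by
    simp only [Real.cos_sub, Finset.sum_add_distrib, sq, Finset.sum_mul_sum]
  rw [this]
  nlinarith [sq_nonneg (∑ i ∈ s, Real.sin (g i))]

theorem abs_sum_cos_le {ι : Type*} (s : Finset ι) (g : ι → ℝ) :
    |∑ i ∈ s, Real.cos (g i)| ≤ s.card := by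
  refine (Finset.abs_sum_le_sum_abs _ _).trans ?_
  refine (Finset.sum_le_sum fun i _ => Real.abs_cos_le_one (g i)).trans ?_
  simp

namespace IsShiftMean

variable {M : (ℕ → ℝ) →ₗ[ℝ] ℝ}

theorem mean_sq_sum_cos_le (hM : IsShiftMean M) (K : ℕ) (g : ℕ → ℕ → ℝ)
    (h : ∀ i j, i ≠ j → M (fun n => Real.cos (g i n - g j n)) = 0) :
    M (fun n => (∑ i ∈ Finset.range K, Real.cos (g i n)) ^ 2) ≤ K := by
  have h1 : M (fun n => (∑ i ∈ Finset.range K, Real.cos (g i n)) ^ 2) ≤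
      M (fun n => ∑ i ∈ Finset.range K, ∑ j ∈ Finset.range K, Real.cos (g i n - g j n)) := by
    refine hM.mono ⟨(K : ℝ) ^ 2, fun n => ?_⟩ ⟨(K : ℝ) * K, fun n => ?_⟩
      fun n => sq_sum_cos_le _ _
    · rw [abs_pow]
      gcongr
      simpa using abs_sum_cos_le (Finset.range K) (fun i => g i n)
    · refine (Finset.abs_sum_le_sum_abs _ _).trans ?_
      refine (Finset.sum_le_sum fun i _ => abs_sum_cos_le _ _).trans ?_
      simp
  refine h1.trans (le_of_eq ?_)
  have e : (fun n => ∑ i ∈ Finset.range K, ∑ j ∈ Finset.range K, Real.cos (g i n - g j n)) =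
      ∑ i ∈ Finset.range K, ∑ j ∈ Finset.range K, fun n => Real.cos (g i n - g j n) := by
    ext n; simp [Finset.sum_apply]
  rw [e, map_sum]
  have : ∀ i ∈ Finset.range K,
      M (∑ j ∈ Finset.range K, fun n => Real.cos (g i n - g j n)) = 1 := by
    intro i hi
    rw [map_sum, Finset.sum_eq_single_of_mem i hi]
    · simp [hM.one]
    · intro j _ hj
      exact h i j hj.symm
  rw [Finset.sum_congr rfl this]
  simp

theorem mean_cos_eq_zero_of_differences (hM : IsShiftMean M) (φ : ℕ → ℝ)
    (h : ∀ t, 1 ≤ t → M (fun n => Real.cos (φ (n + t) - φ n)) = 0) :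
    M (fun n => Real.cos (φ n)) = 0 := by
  have hb : ∀ ψ : ℕ → ℝ, ∃ C, ∀ n, |Real.cos (ψ n)| ≤ C :=
    fun ψ => ⟨1, fun n => Real.abs_cos_le_one _⟩
  have key : ∀ K : ℕ, (K * M (fun n => Real.cos (φ n))) ^ 2 ≤ K := by
    intro K
    have hlt : ∀ i j, i < j → M (fun n => Real.cos (φ (n + j) - φ (n + i))) = 0 := by
      intro i j hij
      have := hM.shift_add (hb (fun n => φ (n + (j - i)) - φ n)) i
      rw [h (j - i) (by omega)] at this
      rw [← this]
      congr 1; ext n; congr 3; omega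
    have h1 := hM.mean_sq_sum_cos_le K (fun i n => φ (n + i)) (by
      intro i j hij
      rcases lt_or_gt_of_ne hij with hlt' | hlt'
      · rw [← hlt i j hlt']
        congr 1; ext n
        rw [← Real.cos_neg]; congr 1; ring
      · exact hlt j i hlt')
    refine le_trans ?_ h1
    have h2 := hM.sq_le (g := fun n => ∑ i ∈ Finset.range K, Real.cos (φ (n + i)))
      ⟨K, fun n => by simpa using abs_sum_cos_le (Finset.range K) (fun i => φ (n + i))⟩
    refine le_trans (le_of_eq ?_) h2
    congr 1
    have e : (fun n => ∑ i ∈ Finset.range K, Real.cos (φ (n + i))) =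
        ∑ i ∈ Finset.range K, fun n => Real.cos (φ (n + i)) := by
      ext n; simp [Finset.sum_apply]
    rw [e, map_sum, Finset.sum_congr rfl fun i _ => hM.shift_add (hb φ) i]
    simp
  by_contra hne
  have hpos : 0 < M (fun n => Real.cos (φ n)) ^ 2 := by positivity
  obtain ⟨K, hK⟩ := exists_nat_gt (1 / M (fun n => Real.cos (φ n)) ^ 2)
  rw [div_lt_iff₀ hpos] at hK
  have hK0 : (0 : ℝ) < K := by
    rcases Nat.eq_zero_or_pos K with rfl | h0
    · norm_num at hK
    · exact_mod_cast h0
  have := key K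
  nlinarith

theorem mean_cos_eq_zero_of_rotation (hM : IsShiftMean M) (φ : ℕ → ℝ) (Q : ℕ) (β : ℝ)
    (hβ : Irrational β) (h : ∀ n, ∃ z : ℤ, φ (n + Q) - φ n = β + z) :
    M (fun n => Real.cos (2 * Real.pi * φ n)) = 0 := by
  have hb : ∃ C, ∀ n, |Real.cos (2 * Real.pi * φ n)| ≤ C := ⟨1, fun n => Real.abs_cos_le_one _⟩
  have h1 := hM.shift_add hb Q
  have h2 := hM.shift_add hb (Q + Q)
  have e : (fun n => Real.cos (2 * Real.pi * φ (n + (Q + Q)))) +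
      (fun n => Real.cos (2 * Real.pi * φ n)) =
      (2 * Real.cos (2 * Real.pi * β)) • fun n => Real.cos (2 * Real.pi * φ (n + Q)) := by
    ext n
    obtain ⟨z, hz⟩ := h n
    obtain ⟨w, hw⟩ := h (n + Q)
    have e1 : 2 * Real.pi * φ (n + (Q + Q)) =
        2 * Real.pi * φ (n + Q) + 2 * Real.pi * β + w * (2 * Real.pi) := by
      rw [← add_assoc]; linear_combination (2 * Real.pi) * hw
    have e2 : 2 * Real.pi * φ n =
        2 * Real.pi * φ (n + Q) - 2 * Real.pi * β - z * (2 * Real.pi) := by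
      linear_combination (-2 * Real.pi) * hz
    simp only [Pi.add_apply, Pi.smul_apply, smul_eq_mul]
    rw [e1, e2, Real.cos_add_int_mul_two_pi, Real.cos_sub_int_mul_two_pi, Real.cos_add,
      Real.cos_sub]
    ring
  have h3 := congrArg M e
  rw [map_add, map_smul, h1, h2, smul_eq_mul] at h3
  have hne : Real.cos (2 * Real.pi * β) ≠ 1 := by
    intro h1
    obtain ⟨z, hz⟩ := (Real.cos_eq_one_iff _).1 h1
    refine hβ ⟨z, ?_⟩
    have hpi := Real.pi_pos
    have : (2 * Real.pi) * (β - z) = 0 := by linear_combination -hz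
    rcases mul_eq_zero.1 this with h | h
    · linarith
    · push_cast; linarith
  have h4 : (1 - Real.cos (2 * Real.pi * β)) * M (fun n => Real.cos (2 * Real.pi * φ n)) = 0 := by
    linarith
  exact (mul_eq_zero.1 h4).resolve_left (sub_ne_zero.2 hne.symm)

end IsShiftMean

/-- The highest irrational coefficient of `P` is that of `X ^ j`. -/
def HasTopIrrationalCoeff (j : ℕ) (P : Polynomial ℝ) : Prop :=
  Irrational (P.coeff j) ∧ ∀ i, j < i → P.coeff i ∈ (Rat.castHom ℝ).fieldRange

theorem HasTopIrrationalCoeff.taylor_sub {j : ℕ} {P : Polynomial ℝ}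
    (hP : HasTopIrrationalCoeff (j + 1) P) {t : ℕ} (ht : 1 ≤ t) :
    HasTopIrrationalCoeff j (Polynomial.taylor (t : ℝ) P - P) := by
  have hc : ∀ i, ∃ N, (Polynomial.taylor (t : ℝ) P - P).coeff i =
      (∑ n ∈ Finset.range N, ((n + 2 + i).choose i : ℝ) * P.coeff (n + 2 + i) * (t : ℝ) ^ (n + 2))
        + ((1 + i).choose i : ℝ) * P.coeff (1 + i) * t := by
    intro i
    refine ⟨(Polynomial.hasseDeriv i P).natDegree, ?_⟩
    rw [Polynomial.coeff_sub, Polynomial.taylor_coeff,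
      Polynomial.eval_eq_sum_range' (n := (Polynomial.hasseDeriv i P).natDegree + 2) (by omega),
      Finset.sum_range_succ', Finset.sum_range_succ']
    simp only [Polynomial.hasseDeriv_coeff]
    simp [add_assoc]
    ring
  have hnat : ∀ m : ℕ, (m : ℝ) ∈ (Rat.castHom ℝ).fieldRange := fun m => natCast_mem _ m
  constructor
  · obtain ⟨N, hN⟩ := hc j
    rw [hN]
    have hr : ∑ n ∈ Finset.range N, ((n + 2 + j).choose j : ℝ) * P.coeff (n + 2 + j) *
        (t : ℝ) ^ (n + 2) ∈ (Rat.castHom ℝ).fieldRange :=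
      sum_mem fun n _ => mul_mem (mul_mem (hnat _) (hP.2 _ (by omega))) (pow_mem (hnat _) _)
    obtain ⟨q, hq⟩ := hr
    rw [← hq]
    refine Irrational.ratCast_add q ?_
    have h1 : (1 + j).choose j ≠ 0 := (Nat.choose_pos (by omega)).ne'
    have := (hP.1.natCast_mul h1).mul_natCast (m := t) (by omega)
    rwa [add_comm j 1] at this
  · intro i hi
    obtain ⟨N, hN⟩ := hc i
    rw [hN]
    refine add_mem (sum_mem fun n _ => mul_mem (mul_mem (hnat _) (hP.2 _ (by omega)))
      (pow_mem (hnat _) _)) (mul_mem (mul_mem (hnat _) (hP.2 _ (by omega))) (hnat _))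

theorem HasTopIrrationalCoeff.exists_period {P : Polynomial ℝ} (hP : HasTopIrrationalCoeff 1 P) :
    ∃ Q : ℕ, ∃ β : ℝ, Irrational β ∧
      ∀ n : ℕ, ∃ z : ℤ, P.eval ((n + Q : ℕ) : ℝ) - P.eval (n : ℝ) = β + z := by
  have hrat : ∀ i, ∃ q : ℚ, 1 < i → (q : ℝ) = P.coeff i := by
    intro i
    by_cases hi : 1 < i
    · obtain ⟨q, hq⟩ := hP.2 i hi
      exact ⟨q, fun _ => hq⟩
    · exact ⟨0, fun h => absurd h hi⟩
  choose q hq using hrat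
  set Q : ℕ := ∏ i ∈ Finset.range (P.natDegree + 2), (q i).den with hQ
  have hQ0 : Q ≠ 0 := Finset.prod_ne_zero_iff.2 fun i _ => (q i).den_nz
  refine ⟨Q, P.coeff 1 * Q, hP.1.mul_natCast hQ0, fun n => ?_⟩
  have hterm : ∀ i ∈ Finset.range (P.natDegree + 2), P.coeff i * ((n + Q : ℕ) : ℝ) ^ i -
      P.coeff i * (n : ℝ) ^ i - (if i = 1 then P.coeff 1 * Q else 0) ∈
        (Int.castAddHom ℝ).range := by
    intro i hi
    rcases Nat.lt_or_ge 1 i with h1 | h1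
    · obtain ⟨c, hc⟩ : (Q : ℤ) ∣ ((n + Q : ℕ) : ℤ) ^ i - (n : ℤ) ^ i := by
        have := sub_dvd_pow_sub_pow ((n + Q : ℕ) : ℤ) (n : ℤ) i
        simpa using this
      obtain ⟨e, he⟩ : (q i).den ∣ Q := Finset.dvd_prod_of_mem _ hi
      refine ⟨(q i).num * e * c, ?_⟩
      have hc' : ((n + Q : ℕ) : ℝ) ^ i - (n : ℝ) ^ i = Q * c := by exact_mod_cast hc
      have hd : (q i : ℝ) * (q i).den = (q i).num := by exact_mod_cast Rat.mul_den_eq_num (q i)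
      have he' : (Q : ℝ) = (q i).den * e := by exact_mod_cast he
      rw [if_neg (by omega), ← hq i h1]
      simp only [Int.coe_castAddHom]
      push_cast at hc' ⊢
      rw [he'] at hc'
      rw [he', ← hd]
      linear_combination (-(q i : ℝ)) * hc'
    · interval_cases i
      · simp
      · refine ⟨0, ?_⟩
        push_cast; simp; ring
  have hsum := sum_mem hterm
  rw [Finset.sum_sub_distrib, Finset.sum_sub_distrib, Finset.sum_ite_eq' ,
    if_pos (Finset.mem_range.2 (by omega)), ← Polynomial.eval_eq_sum_range' (by omega),
    ← Polynomial.eval_eq_sum_range' (by omega)] at hsum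
  obtain ⟨z, hz⟩ := hsum
  refine ⟨z, ?_⟩
  simp only [Int.coe_castAddHom] at hz
  linarith

theorem IsShiftMean.mean_cos_poly_eq_zero {M : (ℕ → ℝ) →ₗ[ℝ] ℝ} (hM : IsShiftMean M) (j : ℕ) :
    ∀ P : Polynomial ℝ, HasTopIrrationalCoeff (j + 1) P →
      M (fun n => Real.cos (2 * Real.pi * P.eval (n : ℝ))) = 0 := by
  induction j with
  | zero =>
    intro P hP
    obtain ⟨Q, β, hβ, h⟩ := hP.exists_period
    exact hM.mean_cos_eq_zero_of_rotation (fun n => P.eval (n : ℝ)) Q β hβ h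
  | succ j ih =>
    intro P hP
    refine hM.mean_cos_eq_zero_of_differences _ fun t ht => ?_
    rw [← ih _ (hP.taylor_sub ht)]
    congr 1; ext n; congr 1
    rw [Polynomial.eval_sub, Polynomial.taylor_eval]
    push_cast; ring

theorem HasTopIrrationalCoeff.smul {j : ℕ} {P : Polynomial ℝ} (hP : HasTopIrrationalCoeff j P)
    {c : ℤ} (hc : c ≠ 0) : HasTopIrrationalCoeff j (Polynomial.C (c : ℝ) * P) := by
  refine ⟨?_, fun i hi => ?_⟩
  · rw [Polynomial.coeff_C_mul]
    exact hP.1.intCast_mul hc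
  · rw [Polynomial.coeff_C_mul]
    exact mul_mem (intCast_mem _ c) (hP.2 i hi)

theorem HasTopIrrationalCoeff.sub_const {j : ℕ} {P : Polynomial ℝ}
    (hP : HasTopIrrationalCoeff (j + 1) P) (c : ℝ) :
    HasTopIrrationalCoeff (j + 1) (P - Polynomial.C c) := by
  refine ⟨?_, fun i hi => ?_⟩
  · rw [Polynomial.coeff_sub, Polynomial.coeff_C_succ, sub_zero]
    exact hP.1
  · rw [Polynomial.coeff_sub, Polynomial.coeff_C_of_ne_zero (by omega), sub_zero]
    exact hP.2 i hi

theorem exists_hasTopIrrationalCoeff {P : Polynomial ℝ} (h : ∃ i, 1 ≤ i ∧ Irrational (P.coeff i)) :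
    ∃ j, HasTopIrrationalCoeff (j + 1) P := by
  classical
  obtain ⟨i, hi, hirr⟩ := h
  have hb : ∀ l, Irrational (P.coeff l) → l ≤ P.natDegree := fun l hl =>
    Polynomial.le_natDegree_of_ne_zero hl.ne_zero
  refine ⟨Nat.findGreatest (fun l => Irrational (P.coeff l)) P.natDegree - 1, ?_⟩
  have h1 : i ≤ Nat.findGreatest (fun l => Irrational (P.coeff l)) P.natDegree :=
    Nat.le_findGreatest (hb i hirr) hirr
  rw [Nat.sub_add_cancel (hi.trans h1)]
  refine ⟨Nat.findGreatest_spec (P := fun l => Irrational (P.coeff l)) (hb i hirr) hirr,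
    fun l hl => ?_⟩
  by_contra hn
  have : Irrational (P.coeff l) := fun ⟨q, hq⟩ => hn ⟨q, hq⟩
  exact absurd (Nat.le_findGreatest (P := fun l => Irrational (P.coeff l)) (hb l this) this)
    (by omega)

/-- The probability, with respect to the mean `M`, that the sequence `X` takes the value `x`. -/
noncomputable def meanProb (M : (ℕ → ℝ) →ₗ[ℝ] ℝ) {α : Type*} (X : ℕ → α) (x : α) : ℝ :=
  M (Set.indicator {n | X n = x} fun _ => 1)

/-- The Shannon entropy of the sequence `X`, seen as a random variable under the mean `M`. -/
noncomputable def meanEntropy (M : (ℕ → ℝ) →ₗ[ℝ] ℝ) {α : Type*} [Fintype α] (X : ℕ → α) : ℝ :=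
  ∑ x, Real.negMulLog (meanProb M X x)

namespace IsShiftMean

variable {M : (ℕ → ℝ) →ₗ[ℝ] ℝ} {α β γ : Type*}

theorem bounded_indicator (s : Set ℕ) :
    ∃ C, ∀ n, |s.indicator (fun _ => (1 : ℝ)) n| ≤ C := by
  refine ⟨1, fun n => ?_⟩
  by_cases h : n ∈ s <;> simp [h]

theorem indicator_mono (hM : IsShiftMean M) {s t : Set ℕ} (h : s ⊆ t) :
    M (s.indicator fun _ => 1) ≤ M (t.indicator fun _ => 1) :=
  hM.mono (bounded_indicator s) (bounded_indicator t) fun n =>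
    Set.indicator_le_indicator_of_subset h (fun _ => zero_le_one) n

theorem prob_nonneg (hM : IsShiftMean M) (X : ℕ → α) (x : α) : 0 ≤ meanProb M X x :=
  hM.nonneg _ (bounded_indicator _) fun n => Set.indicator_nonneg (fun _ _ => zero_le_one) n

theorem prob_le_one (hM : IsShiftMean M) (X : ℕ → α) (x : α) : meanProb M X x ≤ 1 := by
  have := hM.indicator_mono (Set.subset_univ {n | X n = x})
  rwa [Set.indicator_univ, hM.one] at this

theorem indicator_eq_sum [Fintype α] (M : (ℕ → ℝ) →ₗ[ℝ] ℝ) (X : ℕ → α) (s : Set ℕ) :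
    M (s.indicator fun _ => 1) = ∑ x, M ({n | X n = x ∧ n ∈ s}.indicator fun _ => 1) := by
  classical
  rw [← map_sum]
  congr 1
  ext n
  rw [Finset.sum_apply, Finset.sum_eq_single (X n)]
  · by_cases h : n ∈ s <;> simp [h]
  · intro x _ hx
    simp [hx.symm]
  · simp

theorem prob_eq_sum_left [Fintype α] (M : (ℕ → ℝ) →ₗ[ℝ] ℝ) (X : ℕ → α) (Y : ℕ → β) (y : β) :
    meanProb M Y y = ∑ x, meanProb M (fun n => (X n, Y n)) (x, y) := by
  rw [meanProb, indicator_eq_sum M X]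
  simp [meanProb]

theorem prob_eq_sum_mid [Fintype β] (M : (ℕ → ℝ) →ₗ[ℝ] ℝ) (X : ℕ → α) (Y : ℕ → β) (Z : ℕ → γ)
    (x : α) (z : γ) : meanProb M (fun n => (X n, Z n)) (x, z) =
      ∑ y, meanProb M (fun n => (X n, Y n, Z n)) (x, y, z) := by
  rw [meanProb, indicator_eq_sum M Y]
  refine Finset.sum_congr rfl fun y _ => ?_
  rw [meanProb]
  congr 2
  ext n
  simp only [Set.mem_ofPred_eq, Prod.mk.injEq]
  tauto

theorem sum_prob [Fintype α] (hM : IsShiftMean M) (X : ℕ → α) : ∑ x, meanProb M X x = 1 := by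
  have := indicator_eq_sum M X Set.univ
  rw [Set.indicator_univ, hM.one] at this
  simpa [meanProb] using this.symm

theorem entropy_le_of_determined [Fintype α] [Fintype β] (hM : IsShiftMean M) {X : ℕ → α}
    {Y : ℕ → β} (h : ∀ n n', X n = X n' → Y n = Y n') : meanEntropy M Y ≤ meanEntropy M X := by
  have hY : ∀ y, meanProb M Y y = ∑ x, meanProb M (fun n => (X n, Y n)) (x, y) :=
    prob_eq_sum_left M X Y
  have hX : ∀ x, meanProb M X x = ∑ y, meanProb M (fun n => (X n, Y n)) (x, y) := by
    intro x
    rw [meanProb, indicator_eq_sum M Y]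
    refine Finset.sum_congr rfl fun y _ => ?_
    rw [meanProb]
    congr 2
    ext n
    simp [and_comm]
  calc meanEntropy M Y
      = ∑ y, ∑ x, -(meanProb M (fun n => (X n, Y n)) (x, y) * Real.log (meanProb M Y y)) := by
        refine Finset.sum_congr rfl fun y _ => ?_
        rw [Finset.sum_neg_distrib, ← Finset.sum_mul, ← hY, Real.negMulLog, neg_mul]
    _ ≤ ∑ y, ∑ x, -(meanProb M (fun n => (X n, Y n)) (x, y) * Real.log (meanProb M X x)) := by
        refine Finset.sum_le_sum fun y _ => Finset.sum_le_sum fun x _ => ?_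
        refine neg_le_neg ?_
        rcases (hM.prob_nonneg (fun n => (X n, Y n)) (x, y)).eq_or_lt with h0 | h0
        · simp [← h0]
        · refine mul_le_mul_of_nonneg_left ?_ h0.le
          have hex : ∃ n, X n = x ∧ Y n = y := by
            by_contra hn
            have : {n | (X n, Y n) = (x, y)} = ∅ := by
              ext n
              simp only [Set.mem_ofPred_eq, Prod.mk.injEq, Set.mem_empty_iff_false, iff_false]
              exact fun h => hn ⟨n, h⟩
            rw [meanProb, this, Set.indicator_empty] at h0
            exact h0.ne' (map_zero M)
          obtain ⟨n₀, rfl, rfl⟩ := hex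
          have hle : meanProb M (fun n => (X n, Y n)) (X n₀, Y n₀) ≤ meanProb M X (X n₀) :=
            hM.indicator_mono fun n hn => (Prod.mk.inj hn).1
          exact Real.log_le_log (h0.trans_le hle) (hM.indicator_mono fun n hn => h n n₀ hn)
    _ = meanEntropy M X := by
        rw [Finset.sum_comm]
        refine Finset.sum_congr rfl fun x _ => ?_
        rw [Finset.sum_neg_distrib, ← Finset.sum_mul, ← hX, Real.negMulLog, neg_mul]

theorem _root_.Real.negMulLog_le_sub_add {p q : ℝ} (hp : 0 ≤ p) (hq : 0 ≤ q)
    (h : p ≠ 0 → q ≠ 0) : Real.negMulLog p ≤ -(p * Real.log q) + q - p := by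
  rcases hp.eq_or_lt with rfl | hp
  · simpa using hq
  · have hq : 0 < q := hq.lt_of_ne' (h hp.ne')
    have h1 := Real.log_le_sub_one_of_pos (div_pos hq hp)
    rw [Real.log_div hq.ne' hp.ne'] at h1
    have h2 := mul_le_mul_of_nonneg_left h1 hp.le
    have h3 : p * (q / p - 1) = q - p := by field_simp
    rw [Real.negMulLog]
    linarith

theorem entropy_submodular [Fintype α] [Fintype β] [Fintype γ] (hM : IsShiftMean M)
    (X : ℕ → α) (Y : ℕ → β) (Z : ℕ → γ) :
    meanEntropy M (fun n => (X n, Y n, Z n)) + meanEntropy M Z ≤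
      meanEntropy M (fun n => (X n, Z n)) + meanEntropy M (fun n => (Y n, Z n)) := by
  set p := fun x y z => meanProb M (fun n => (X n, Y n, Z n)) (x, y, z)
  set a := fun x z => meanProb M (fun n => (X n, Z n)) (x, z)
  set b := fun y z => meanProb M (fun n => (Y n, Z n)) (y, z)
  set c := meanProb M Z
  have hp0 : ∀ x y z, 0 ≤ p x y z := fun x y z => hM.prob_nonneg _ _
  have hpa : ∀ x y z, p x y z ≤ a x z := fun x y z => hM.indicator_mono fun n hn => by
    simp only [Set.mem_ofPred_eq, Prod.mk.injEq] at hn ⊢; tauto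
  have hpb : ∀ x y z, p x y z ≤ b y z := fun x y z => hM.indicator_mono fun n hn => by
    simp only [Set.mem_ofPred_eq, Prod.mk.injEq] at hn ⊢; tauto
  have hac : ∀ x z, a x z ≤ c z := fun x z => hM.indicator_mono fun n hn => by
    simp only [Set.mem_ofPred_eq, Prod.mk.injEq] at hn ⊢; tauto
  have ha0 : ∀ x z, 0 ≤ a x z := fun x z => hM.prob_nonneg _ _
  have hb0 : ∀ y z, 0 ≤ b y z := fun y z => hM.prob_nonneg _ _
  have hc0 : ∀ z, 0 ≤ c z := fun z => hM.prob_nonneg _ _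
  have hsa : ∀ x z, ∑ y, p x y z = a x z := fun x z => (prob_eq_sum_mid M X Y Z x z).symm
  have hsb : ∀ y z, ∑ x, p x y z = b y z := fun y z =>
    (prob_eq_sum_left M X (fun n => (Y n, Z n)) (y, z)).symm
  have hsac : ∀ z, ∑ x, a x z = c z := fun z => (prob_eq_sum_left M X Z z).symm
  have hsbc : ∀ z, ∑ y, b y z = c z := fun z => (prob_eq_sum_left M Y Z z).symm
  have hterm : ∀ z x y, Real.negMulLog (p x y z) ≤ -(p x y z * Real.log (a x z)) -
      p x y z * Real.log (b y z) + p x y z * Real.log (c z) + a x z * b y z / c z - p x y z := by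
    intro z x y
    rcases (hp0 x y z).eq_or_lt with h0 | h0
    · rw [← h0]
      simpa using div_nonneg (mul_nonneg (ha0 x z) (hb0 y z)) (hc0 z)
    · have h1 := h0.trans_le (hpa x y z)
      have h2 := h0.trans_le (hpb x y z)
      have h3 := h1.trans_le (hac x z)
      have h4 := Real.negMulLog_le_sub_add h0.le (q := a x z * b y z / c z) (by positivity)
        (fun _ => by positivity)
      rw [Real.log_div (by positivity) h3.ne', Real.log_mul h1.ne' h2.ne'] at h4
      linarith
  have hsum := Finset.sum_le_sum fun z (_ : z ∈ Finset.univ) =>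
    Finset.sum_le_sum fun x (_ : x ∈ Finset.univ) =>
      Finset.sum_le_sum fun y (_ : y ∈ Finset.univ) => hterm z x y
  simp only [Finset.sum_add_distrib, Finset.sum_sub_distrib, Finset.sum_neg_distrib] at hsum
  have e1 : ∑ z, ∑ x, ∑ y, Real.negMulLog (p x y z) =
      meanEntropy M (fun n => (X n, Y n, Z n)) := by
    rw [meanEntropy, Fintype.sum_prod_type, Finset.sum_comm]
    refine Finset.sum_congr rfl fun x _ => ?_
    rw [Fintype.sum_prod_type, Finset.sum_comm]
  have e2 : ∑ z, ∑ x, ∑ y, p x y z * Real.log (a x z) =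
      -meanEntropy M (fun n => (X n, Z n)) := by
    rw [meanEntropy, Fintype.sum_prod_type, Finset.sum_comm, ← Finset.sum_neg_distrib]
    refine Finset.sum_congr rfl fun x _ => ?_
    rw [← Finset.sum_neg_distrib]
    refine Finset.sum_congr rfl fun z _ => ?_
    rw [← Finset.sum_mul, hsa, Real.negMulLog]
    ring
  have e3 : ∑ z, ∑ x, ∑ y, p x y z * Real.log (b y z) =
      -meanEntropy M (fun n => (Y n, Z n)) := by
    rw [meanEntropy, Fintype.sum_prod_type, Finset.sum_comm' (t' := Finset.univ)
      (s' := fun _ => Finset.univ) (by simp), ← Finset.sum_neg_distrib, Finset.sum_comm]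
    simp_rw [← Finset.sum_neg_distrib]
    rw [Finset.sum_comm (s := (Finset.univ : Finset β))]
    refine Finset.sum_congr rfl fun z _ => ?_
    rw [Finset.sum_comm]
    refine Finset.sum_congr rfl fun y _ => ?_
    rw [← Finset.sum_mul, hsb, Real.negMulLog]
    ring
  have e4 : ∑ z, ∑ x, ∑ y, p x y z * Real.log (c z) = -meanEntropy M Z := by
    rw [meanEntropy, ← Finset.sum_neg_distrib]
    refine Finset.sum_congr rfl fun z _ => ?_
    simp_rw [← Finset.sum_mul, hsa, hsac, Real.negMulLog]
    ring
  have e5 : ∑ z, ∑ x, ∑ y, a x z * b y z / c z = 1 := by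
    rw [← hM.sum_prob Z]
    refine Finset.sum_congr rfl fun z _ => ?_
    simp_rw [← Finset.sum_div, ← Finset.mul_sum, hsbc, ← Finset.sum_mul, hsac]
    rw [mul_self_div_self]
  have e6 : ∑ z, ∑ x, ∑ y, p x y z = 1 := by
    rw [← hM.sum_prob Z]
    refine Finset.sum_congr rfl fun z _ => ?_
    simp_rw [hsa, hsac]
    rfl
  rw [e1, e2, e3, e4, e5, e6] at hsum
  linarith

theorem entropy_le_log_card [Fintype α] (hM : IsShiftMean M) {X : ℕ → α} {s : Finset α}
    (hs : ∀ n, X n ∈ s) : meanEntropy M X ≤ Real.log s.card := by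
  have hc : (0 : ℝ) < s.card := by exact_mod_cast Finset.card_pos.2 ⟨X 0, hs 0⟩
  have hzero : ∀ x, x ∉ s → meanProb M X x = 0 := by
    intro x hx
    have : {n | X n = x} = ∅ := by
      ext n
      simp only [Set.mem_ofPred_eq, Set.mem_empty_iff_false, iff_false]
      rintro rfl
      exact hx (hs n)
    rw [meanProb, this, Set.indicator_empty]
    exact map_zero M
  have h1 : meanEntropy M X = ∑ x ∈ s, Real.negMulLog (meanProb M X x) :=
    (Finset.sum_subset (Finset.subset_univ s) fun x _ hx => by simp [hzero x hx]).symm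
  have h2 : ∑ x ∈ s, meanProb M X x = 1 := by
    rw [← hM.sum_prob X]
    exact Finset.sum_subset (Finset.subset_univ s) fun x _ hx => hzero x hx
  have h3 := Finset.sum_le_sum fun x (_ : x ∈ s) =>
    Real.negMulLog_le_sub_add (hM.prob_nonneg X x) (q := (s.card : ℝ)⁻¹) (by positivity)
      (fun _ => by positivity)
  rw [Finset.sum_sub_distrib, Finset.sum_add_distrib, Finset.sum_neg_distrib, ← Finset.sum_mul,
    h2, Real.log_inv, Finset.sum_const, nsmul_eq_mul, mul_inv_cancel₀ hc.ne'] at h3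
  rw [h1]
  linarith

theorem neg_log_le_entropy [Fintype α] (hM : IsShiftMean M) {X : ℕ → α} {c : ℝ}
    (hX : ∀ x, meanProb M X x ≤ c) : -Real.log c ≤ meanEntropy M X := by
  calc -Real.log c = ∑ x, -(meanProb M X x * Real.log c) := by
        rw [Finset.sum_neg_distrib, ← Finset.sum_mul, hM.sum_prob, one_mul]
    _ ≤ meanEntropy M X := by
        refine Finset.sum_le_sum fun x _ => ?_
        rw [Real.negMulLog, neg_mul, neg_le_neg_iff]
        rcases (hM.prob_nonneg X x).eq_or_lt with h0 | h0
        · simp [← h0]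
        · exact mul_le_mul_of_nonneg_left (Real.log_le_log h0 (hX x)) h0.le

theorem entropy_nonneg [Fintype α] (hM : IsShiftMean M) (X : ℕ → α) : 0 ≤ meanEntropy M X := by
  simpa using hM.neg_log_le_entropy (hM.prob_le_one X)

theorem entropy_pair_le [Fintype α] [Fintype β] (hM : IsShiftMean M) (X : ℕ → α) (Y : ℕ → β) :
    meanEntropy M (fun n => (X n, Y n)) ≤ meanEntropy M X + meanEntropy M Y := by
  have h1 := hM.entropy_submodular X Y (fun _ => ())
  have h2 := hM.entropy_nonneg (fun _ => ())
  have h3 : meanEntropy M (fun n => (X n, Y n)) ≤ meanEntropy M (fun n => (X n, Y n, ())) :=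
    hM.entropy_le_of_determined fun n n' h => by simp_all
  have h4 : meanEntropy M (fun n => (X n, ())) ≤ meanEntropy M X :=
    hM.entropy_le_of_determined fun n n' h => by simp_all
  have h5 : meanEntropy M (fun n => (Y n, ())) ≤ meanEntropy M Y :=
    hM.entropy_le_of_determined fun n n' h => by simp_all
  linarith

theorem entropy_bool_le (hM : IsShiftMean M) (E : ℕ → Bool) : meanEntropy M E ≤ Real.log 2 := by
  simpa using hM.entropy_le_log_card (s := Finset.univ) (X := E) (by simp)

theorem entropy_shift [Fintype α] (hM : IsShiftMean M) (X : ℕ → α) (t : ℕ) :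
    meanEntropy M (fun n => X (n + t)) = meanEntropy M X := by
  refine Finset.sum_congr rfl fun x _ => ?_
  congr 1
  exact hM.shift_add (bounded_indicator {n | X n = x}) t

/-- If `Z` determines the translate `A (· + t l)` up to one bit for all `l < L`, then the joint
entropy of `Z` and `L` blocks of `V` is at most that of `Z` plus `L` times the entropy of `V`
conditional on `A`, up to `L` bits. -/
theorem entropy_blocks_le [Fintype α] [Fintype β] [Fintype γ] (hM : IsShiftMean M)
    {ω : ℕ → Type*} [∀ L, Fintype (ω L)] (W : (L : ℕ) → ℕ → ω L) (V : ℕ → β) (A : ℕ → α)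
    (Z : ℕ → γ) (t : ℕ → ℕ) (hW0 : ∀ n n', W 0 n = W 0 n')
    (hW : ∀ L n n', W L n = W L n' → V (n + t L) = V (n' + t L) → W (L + 1) n = W (L + 1) n')
    (L : ℕ) (hZ : ∀ l < L, ∃ E : ℕ → Bool, ∀ n n', Z n = Z n' → E n = E n' →
      A (n + t l) = A (n' + t l)) :
    meanEntropy M (fun n => (W L n, Z n)) ≤ meanEntropy M Z +
      L * (meanEntropy M (fun n => (V n, A n)) - meanEntropy M A + Real.log 2) := by
  induction L with
  | zero =>
    simpa using hM.entropy_le_of_determined (X := Z) (Y := fun n => (W 0 n, Z n))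
      fun n n' h => by simp [h, hW0 n n']
  | succ L ih =>
    have ih := ih fun l hl => hZ l (by omega)
    obtain ⟨E, hE⟩ := hZ L (by omega)
    have h1 : meanEntropy M (fun n => (W (L + 1) n, Z n)) ≤
        meanEntropy M (fun n => (W L n, V (n + t L), Z n)) :=
      hM.entropy_le_of_determined fun n n' h => by
        simp only [Prod.mk.injEq] at h ⊢
        exact ⟨hW L n n' h.1 h.2.1, h.2.2⟩
    have h2 := hM.entropy_submodular (W L) (fun n => V (n + t L)) Z
    have h3 : meanEntropy M (fun n => (V (n + t L), Z n)) ≤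
        meanEntropy M (fun n => (V (n + t L), Z n, A (n + t L))) :=
      hM.entropy_le_of_determined fun n n' h => by
        simp only [Prod.mk.injEq] at h ⊢
        exact ⟨h.1, h.2.1⟩
    have h4 := hM.entropy_submodular (fun n => V (n + t L)) Z (fun n => A (n + t L))
    have h5 : meanEntropy M (fun n => (Z n, A (n + t L))) ≤ meanEntropy M (fun n => (Z n, E n)) :=
      hM.entropy_le_of_determined fun n n' h => by
        simp only [Prod.mk.injEq] at h ⊢
        exact ⟨h.1, hE n n' h.1 h.2⟩
    have h6 := hM.entropy_pair_le Z E
    have h7 := hM.entropy_bool_le E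
    have h8 := hM.entropy_shift A (t L)
    have h9 := hM.entropy_shift (fun n => (V n, A n)) (t L)
    push_cast
    linarith

end IsShiftMean

/-- The index modulo `2 ^ m` of the dyadic interval of length `2 ^ (-m)` containing `x`. -/
noncomputable def dyadicCell (m : ℕ) (x : ℝ) : ZMod (2 ^ m) := (⌊(2 : ℝ) ^ m * x⌋ : ℤ)

theorem dyadicCell_eq_iff {m : ℕ} {x y : ℝ} : dyadicCell m x = dyadicCell m y ↔
    (2 : ℤ) ^ m ∣ ⌊(2 : ℝ) ^ m * y⌋ - ⌊(2 : ℝ) ^ m * x⌋ := by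
  rw [dyadicCell, dyadicCell, ZMod.intCast_eq_intCast_iff_dvd_sub]
  push_cast
  rfl

theorem dyadicCell_add_eq_of_eq {a b : ℕ} {x y : ℝ} (h₁ : dyadicCell a x = dyadicCell a y)
    (h₂ : dyadicCell b (2 ^ a * x) = dyadicCell b (2 ^ a * y)) :
    dyadicCell (a + b) x = dyadicCell (a + b) y := by
  have key : ∀ x : ℝ, 0 ≤ ⌊(2 : ℝ) ^ (a + b) * x⌋ - 2 ^ b * ⌊(2 : ℝ) ^ a * x⌋ ∧
      ⌊(2 : ℝ) ^ (a + b) * x⌋ - 2 ^ b * ⌊(2 : ℝ) ^ a * x⌋ < 2 ^ b := by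
    intro x
    have hb : (0 : ℝ) < 2 ^ b := by positivity
    have e : (2 : ℝ) ^ (a + b) * x = 2 ^ b * (2 ^ a * x) := by ring
    have h1 := mul_le_mul_of_nonneg_left (Int.floor_le ((2 : ℝ) ^ a * x)) hb.le
    have h2 := mul_lt_mul_of_pos_left (Int.lt_floor_add_one ((2 : ℝ) ^ a * x)) hb
    constructor
    · rw [sub_nonneg, Int.le_floor, e]
      push_cast
      exact h1
    · have : ⌊(2 : ℝ) ^ (a + b) * x⌋ < 2 ^ b * (⌊(2 : ℝ) ^ a * x⌋ + 1) := by
        rw [Int.floor_lt, e]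
        push_cast
        exact h2
      linarith
  rw [dyadicCell_eq_iff] at h₁ h₂ ⊢
  obtain ⟨kx0, kx1⟩ := key x
  obtain ⟨ky0, ky1⟩ := key y
  rw [← mul_assoc, ← mul_assoc, ← pow_add, add_comm b a] at h₂
  set vx := ⌊(2 : ℝ) ^ (a + b) * x⌋
  set vy := ⌊(2 : ℝ) ^ (a + b) * y⌋
  set ux := ⌊(2 : ℝ) ^ a * x⌋
  set uy := ⌊(2 : ℝ) ^ a * y⌋
  have hw : (2 : ℤ) ^ b ∣ (vy - 2 ^ b * uy) - (vx - 2 ^ b * ux) := by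
    have : (vy - 2 ^ b * uy) - (vx - 2 ^ b * ux) = (vy - vx) - 2 ^ b * (uy - ux) := by ring
    rw [this]
    exact dvd_sub h₂ (dvd_mul_right _ _)
  have hw0 := Int.eq_zero_of_abs_lt_dvd hw (by rw [abs_lt]; constructor <;> linarith)
  obtain ⟨c, hc⟩ := h₁
  refine ⟨c, ?_⟩
  rw [pow_add]
  linear_combination hw0 + 2 ^ b * hc

theorem dyadicCell_add (m : ℕ) (x y : ℝ) :
    dyadicCell m (x + y) = dyadicCell m x + dyadicCell m y ∨
      dyadicCell m (x + y) = dyadicCell m x + dyadicCell m y + 1 := by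
  simp only [dyadicCell, mul_add]
  set u := (2 : ℝ) ^ m * x
  set v := (2 : ℝ) ^ m * y
  have h1 := Int.le_floor_add u v
  have h2 := Int.le_floor_add_floor u v
  rcases (show ⌊u + v⌋ = ⌊u⌋ + ⌊v⌋ ∨ ⌊u + v⌋ = ⌊u⌋ + ⌊v⌋ + 1 by omega) with h | h
  · left; rw [h]; push_cast; rfl
  · right; rw [h]; push_cast; rfl

theorem dyadicCell_fract (m : ℕ) (x : ℝ) : dyadicCell m (Int.fract x) = dyadicCell m x := by
  rw [dyadicCell_eq_iff]
  have : (2 : ℝ) ^ m * x = 2 ^ m * Int.fract x + ((2 ^ m * ⌊x⌋ : ℤ) : ℝ) := by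
    push_cast
    rw [← mul_add, Int.fract_add_floor]
  rw [this, Int.floor_add_intCast]
  exact ⟨⌊x⌋, by ring⟩

theorem HasTopIrrationalCoeff.prob_dyadicCell_le {M : (ℕ → ℝ) →ₗ[ℝ] ℝ} (hM : IsShiftMean M)
    {j : ℕ} {P : Polynomial ℝ} (hP : HasTopIrrationalCoeff (j + 1) P) (m : ℕ)
    (x : ZMod (2 ^ (m + 3))) :
    meanProb M (fun n => dyadicCell (m + 3) (P.eval (n : ℝ))) x ≤ 4 / 2 ^ m := by
  set c : ℝ := x.val / 2 ^ (m + 3) with hc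
  set K : ℕ := 2 ^ m with hK
  have hK0 : (0 : ℝ) < K := by positivity
  have h1 := hM.mean_sq_sum_cos_le K
    (fun i n => 2 * Real.pi * ((i : ℝ) * (P.eval (n : ℝ) - c))) (by
      intro i i' hne
      have hz : (i : ℤ) - i' ≠ 0 := sub_ne_zero.2 (by exact_mod_cast hne)
      rw [← hM.mean_cos_poly_eq_zero j _ ((hP.sub_const c).smul hz)]
      congr 1; ext n; congr 1
      simp only [Polynomial.eval_mul, Polynomial.eval_C, Polynomial.eval_sub]
      push_cast; ring)
  have h2 : meanProb M (fun n => dyadicCell (m + 3) (P.eval (n : ℝ))) x ≤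
      M ((4 / (K : ℝ) ^ 2) • fun n : ℕ => (∑ i ∈ Finset.range K,
        Real.cos (2 * Real.pi * ((i : ℝ) * (P.eval (n : ℝ) - c)))) ^ 2) := by
    refine hM.mono (IsShiftMean.bounded_indicator _) ⟨4 / (K : ℝ) ^ 2 * K ^ 2, fun n => ?_⟩
      fun n => ?_
    · rw [Pi.smul_apply, smul_eq_mul, abs_mul, abs_of_nonneg (by positivity), abs_pow]
      gcongr
      simpa using abs_sum_cos_le (Finset.range K)
        (fun i => 2 * Real.pi * ((i : ℝ) * (P.eval (n : ℝ) - c)))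
    · simp only [Set.indicator_apply, Pi.smul_apply, smul_eq_mul]
      split_ifs with hn
      swap
      · positivity
      rw [Set.mem_ofPred_eq] at hn
      set θ := P.eval (n : ℝ)
      obtain ⟨z, hz⟩ : ((2 ^ (m + 3) : ℕ) : ℤ) ∣ ⌊(2 : ℝ) ^ (m + 3) * θ⌋ - x.val := by
        rw [← ZMod.intCast_eq_intCast_iff_dvd_sub]
        simpa [dyadicCell] using hn.symm
      have hz' : (⌊(2 : ℝ) ^ (m + 3) * θ⌋ : ℝ) - x.val = 2 ^ (m + 3) * z := by exact_mod_cast hz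
      have hpow : (0 : ℝ) < 2 ^ (m + 3) := by positivity
      have hcv : 2 ^ (m + 3) * c = x.val := by rw [hc]; field_simp
      have hlo : 0 ≤ θ - c - z := by
        have := Int.floor_le ((2 : ℝ) ^ (m + 3) * θ)
        have h0 : 0 ≤ (2 : ℝ) ^ (m + 3) * (θ - c - z) := by linarith
        exact nonneg_of_mul_nonneg_right h0 hpow
      have hhi : 8 * K * (θ - c - z) ≤ 1 := by
        have := Int.lt_floor_add_one ((2 : ℝ) ^ (m + 3) * θ)
        have e : (8 : ℝ) * K = 2 ^ (m + 3) := by rw [hK]; push_cast; ring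
        rw [e]; linarith
      have hcos : ∀ i ∈ Finset.range K,
          1 / 2 ≤ Real.cos (2 * Real.pi * ((i : ℝ) * (θ - c))) := by
        intro i hi
        have hiK : (i : ℝ) ≤ K := by exact_mod_cast (Finset.mem_range.1 hi).le
        have e : 2 * Real.pi * ((i : ℝ) * (θ - c)) =
            2 * Real.pi * (i * (θ - c - z)) + ((i * z : ℤ) : ℝ) * (2 * Real.pi) := by
          push_cast; ring
        rw [e, Real.cos_add_int_mul_two_pi, ← Real.cos_pi_div_three]
        have hi0 : (0 : ℝ) ≤ i * (θ - c - z) := by positivity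
        have hi1 : (i : ℝ) * (θ - c - z) ≤ 1 / 8 := by
          have := mul_le_mul_of_nonneg_right hiK hlo
          linarith
        have hpi := Real.pi_pos
        refine Real.cos_le_cos_of_nonneg_of_le_pi (by positivity) (by linarith) ?_
        nlinarith
      have hsum : (K : ℝ) * (1 / 2) ≤
          ∑ i ∈ Finset.range K, Real.cos (2 * Real.pi * ((i : ℝ) * (θ - c))) := by
        have := Finset.sum_le_sum hcos
        simpa using this
      have hsq := pow_le_pow_left₀ (by positivity) hsum 2
      calc (1 : ℝ) = 4 / (K : ℝ) ^ 2 * (K * (1 / 2)) ^ 2 := by field_simp; norm_num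
        _ ≤ _ := by gcongr
  rw [map_smul, smul_eq_mul] at h2
  calc _ ≤ _ := h2
    _ ≤ 4 / (K : ℝ) ^ 2 * K := by gcongr
    _ = 4 / 2 ^ m := by rw [hK]; push_cast; field_simp

theorem HasTopIrrationalCoeff.le_entropy_dyadicCell {M : (ℕ → ℝ) →ₗ[ℝ] ℝ} (hM : IsShiftMean M)
    {j : ℕ} {P : Polynomial ℝ} (hP : HasTopIrrationalCoeff (j + 1) P) {m : ℕ} (hm : 3 ≤ m) :
    (m - 5) * Real.log 2 ≤ meanEntropy M (fun n => dyadicCell m (P.eval (n : ℝ))) := by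
  obtain ⟨m, rfl⟩ := Nat.exists_eq_add_of_le' hm
  refine le_trans (le_of_eq ?_) (hM.neg_log_le_entropy (hP.prob_dyadicCell_le hM m))
  rw [Real.log_div (by norm_num) (by positivity), Real.log_pow,
    show (4 : ℝ) = 2 ^ 2 by norm_num, Real.log_pow]
  push_cast
  ring

/-- The cells containing the coefficients of the Taylor expansion of `P` at `n`. -/
noncomputable def taylorCells (k m : ℕ) (P : Polynomial ℝ) (n : ℕ) : Fin (k + 1) → ZMod (2 ^ m) :=
  fun i => dyadicCell m ((Polynomial.taylor (n : ℝ) P).coeff i)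

theorem exists_bool_determining_dyadicCell {k m s t : ℕ} {P : Polynomial ℝ}
    (hP : P.natDegree ≤ k) (ht : ∑ i ∈ Finset.range (k + 1), t ^ i ≤ 2 ^ s) :
    ∃ E : ℕ → Bool, ∀ n n', taylorCells k (m + s) P n = taylorCells k (m + s) P n' → E n = E n' →
      dyadicCell m (P.eval ((n + t : ℕ) : ℝ)) = dyadicCell m (P.eval ((n' + t : ℕ) : ℝ)) := by
  set v : ℕ → ℤ := fun n => ∑ i : Fin (k + 1),
    ⌊(2 : ℝ) ^ (m + s) * (Polynomial.taylor (n : ℝ) P).coeff i⌋ * (t : ℤ) ^ (i : ℕ) with hv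
  set F : ℕ → ℤ := fun n => ⌊(2 : ℝ) ^ m * P.eval ((n + t : ℕ) : ℝ)⌋ with hF
  have hs : (0 : ℝ) < 2 ^ s := by positivity
  have heval : ∀ n : ℕ, P.eval ((n + t : ℕ) : ℝ) =
      ∑ i : Fin (k + 1), (Polynomial.taylor (n : ℝ) P).coeff i * (t : ℝ) ^ (i : ℕ) := by
    intro n
    rw [Fin.sum_univ_eq_sum_range
      (fun i => (Polynomial.taylor (n : ℝ) P).coeff i * (t : ℝ) ^ i) (k + 1),
      ← Polynomial.eval_eq_sum_range' (by rw [Polynomial.natDegree_taylor]; omega),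
      Polynomial.taylor_eval]
    push_cast; ring_nf
  have hbound : ∀ n : ℕ, (v n : ℝ) ≤ 2 ^ s * (2 ^ m * P.eval ((n + t : ℕ) : ℝ)) ∧
      2 ^ s * (2 ^ m * P.eval ((n + t : ℕ) : ℝ)) < v n + 2 ^ s := by
    intro n
    have e : 2 ^ s * (2 ^ m * P.eval ((n + t : ℕ) : ℝ)) = ∑ i : Fin (k + 1),
        (2 : ℝ) ^ (m + s) * (Polynomial.taylor (n : ℝ) P).coeff i * (t : ℝ) ^ (i : ℕ) := by
      rw [heval, Finset.mul_sum, Finset.mul_sum]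
      refine Finset.sum_congr rfl fun i _ => ?_
      rw [pow_add]; ring
    have e' : (v n : ℝ) = ∑ i : Fin (k + 1),
        (⌊(2 : ℝ) ^ (m + s) * (Polynomial.taylor (n : ℝ) P).coeff i⌋ : ℝ) * (t : ℝ) ^ (i : ℕ) := by
      simp [hv]
    constructor
    · rw [e, e']
      refine Finset.sum_le_sum fun i _ => ?_
      gcongr
      exact Int.floor_le _
    · have ht' : ∑ i : Fin (k + 1), (t : ℝ) ^ (i : ℕ) ≤ 2 ^ s := by
        rw [Fin.sum_univ_eq_sum_range (fun i => (t : ℝ) ^ i) (k + 1)]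
        exact_mod_cast ht
      refine lt_of_lt_of_le ?_ (add_le_add_right ht' _)
      rw [e, e', ← Finset.sum_add_distrib]
      refine Finset.sum_lt_sum (fun i _ => ?_) ⟨0, Finset.mem_univ _, ?_⟩
      · rw [← add_one_mul]
        gcongr
        exact (Int.lt_floor_add_one _).le
      · rw [← add_one_mul]
        simp
  have hF01 : ∀ n, F n = v n / 2 ^ s ∨ F n = v n / 2 ^ s + 1 := by
    intro n
    obtain ⟨h1, h2⟩ := hbound n
    have hpos : (0 : ℤ) < 2 ^ s := by positivity
    have h3 : v n / 2 ^ s ≤ F n := by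
      rw [hF, Int.le_floor]
      have := Int.ediv_mul_le (v n) hpos.ne'
      have h' : ((v n / 2 ^ s : ℤ) : ℝ) * 2 ^ s ≤ v n := by exact_mod_cast this
      nlinarith
    have h4 : F n < v n / 2 ^ s + 2 := by
      rw [hF, Int.floor_lt]
      have := Int.lt_ediv_add_one_mul_self (v n) hpos
      have h' : (v n : ℝ) < (((v n / 2 ^ s : ℤ) : ℝ) + 1) * 2 ^ s := by exact_mod_cast this
      rw [Int.cast_add, Int.cast_ofNat]
      refine lt_of_mul_lt_mul_left ?_ hs.le
      linarith
    omega
  refine ⟨fun n => decide (F n = v n / 2 ^ s), fun n n' hZ hE => ?_⟩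
  have hvdvd : (2 : ℤ) ^ (m + s) ∣ v n' - v n := by
    rw [hv, ← Finset.sum_sub_distrib]
    refine Finset.dvd_sum fun i _ => ?_
    rw [← sub_mul]
    exact dvd_mul_of_dvd_left (dyadicCell_eq_iff.1 (congrFun hZ i)) _
  obtain ⟨c, hc⟩ := hvdvd
  have hdiv : v n' / 2 ^ s = v n / 2 ^ s + 2 ^ m * c := by
    have : v n' = v n + 2 ^ m * c * 2 ^ s := by rw [pow_add] at hc; linarith
    rw [this, Int.add_mul_ediv_right _ _ (by positivity)]
  rw [dyadicCell_eq_iff]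
  refine ⟨c, ?_⟩
  change F n' - F n = _
  have hE' := decide_eq_decide.1 hE
  by_cases h : F n = v n / 2 ^ s
  · have := hE'.1 h
    linarith
  · have h' : ¬ F n' = v n' / 2 ^ s := fun h' => h (hE'.2 h')
    have h1 := (hF01 n).resolve_left h
    have h2 := (hF01 n').resolve_left h'
    linarith

/-- The indices of the dyadic intervals of length `2 ^ (-m)` met by `F`. -/
noncomputable def metCells (m : ℕ) (F : Set ℝ) : Finset (ZMod (2 ^ m)) :=
  (Set.toFinite (dyadicCell m '' F)).toFinset

theorem mem_metCells {m : ℕ} {F : Set ℝ} {x : ℝ} (hx : x ∈ F) : dyadicCell m x ∈ metCells m F := by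
  simpa [metCells] using ⟨x, hx, rfl⟩

theorem card_metCells_le {m : ℕ} {F : Set ℝ} {r : ℝ} (hr : 2 ^ m * r ≤ 1) {s : Finset ℝ}
    (hs : F ⊆ ⋃ x ∈ s, Metric.closedBall x (r / 2)) : (metCells m F).card ≤ s.card * 2 := by
  classical
  refine le_trans (Finset.card_le_card ?_) (Finset.card_biUnion_le_card_mul s
    (fun x => {((⌊(2 : ℝ) ^ m * (x - r / 2)⌋ : ℤ) : ZMod (2 ^ m)),
      ((⌊(2 : ℝ) ^ m * (x - r / 2)⌋ + 1 : ℤ) : ZMod (2 ^ m))}) 2 fun x _ => Finset.card_le_two)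
  intro c hc
  simp only [metCells, Set.Finite.mem_toFinset, Set.mem_image] at hc
  obtain ⟨y, hy, rfl⟩ := hc
  obtain ⟨x, hx, hyx⟩ := Set.mem_iUnion₂.1 (hs hy)
  rw [Metric.mem_closedBall, Real.dist_eq, abs_le] at hyx
  rw [Finset.mem_biUnion]
  refine ⟨x, hx, ?_⟩
  have hpos : (0 : ℝ) < 2 ^ m := by positivity
  have h1 : ⌊(2 : ℝ) ^ m * (x - r / 2)⌋ ≤ ⌊(2 : ℝ) ^ m * y⌋ := by
    refine Int.floor_le_floor ?_
    gcongr
    linarith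
  have h2 : ⌊(2 : ℝ) ^ m * y⌋ < ⌊(2 : ℝ) ^ m * (x - r / 2)⌋ + 2 := by
    rw [Int.floor_lt]
    push_cast
    have := Int.lt_floor_add_one ((2 : ℝ) ^ m * (x - r / 2))
    nlinarith
  rw [Finset.mem_insert, Finset.mem_singleton, dyadicCell]
  rcases (show ⌊(2 : ℝ) ^ m * y⌋ = ⌊(2 : ℝ) ^ m * (x - r / 2)⌋ ∨
    ⌊(2 : ℝ) ^ m * y⌋ = ⌊(2 : ℝ) ^ m * (x - r / 2)⌋ + 1 by omega) with h | h <;> simp [h]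

theorem exists_cover_card_le {F : Set ℝ} (hF : F ⊆ Set.Icc 0 1) {r : ℝ} (hr : 0 < r) :
    ∃ s : Finset ℝ, s.card ≤ ⌈1 / r⌉₊ ∧ F ⊆ ⋃ x ∈ s, Metric.closedBall x (r / 2) := by
  classical
  refine ⟨(Finset.range ⌈1 / r⌉₊).image fun i : ℕ => (i + 1 / 2 : ℝ) * r,
    Finset.card_image_le.trans (by simp), fun x hx => ?_⟩
  obtain ⟨hx0, hx1⟩ := hF hx
  have hN : 1 ≤ (⌈1 / r⌉₊ : ℝ) * r := by
    have := Nat.le_ceil (1 / r)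
    rwa [div_le_iff₀ hr] at this
  have hN0 : 0 < ⌈1 / r⌉₊ := Nat.ceil_pos.2 (by positivity)
  have key : ∃ i < ⌈1 / r⌉₊, (i : ℝ) * r ≤ x ∧ x ≤ (i + 1) * r := by
    rcases hx1.eq_or_lt with rfl | hx1
    · refine ⟨⌈1 / r⌉₊ - 1, by omega, ?_, ?_⟩
      · have h := (Nat.lt_ceil (a := 1 / r) (n := ⌈1 / r⌉₊ - 1)).1 (by omega)
        rw [lt_div_iff₀ hr] at h
        exact h.le
      · rw [Nat.cast_sub hN0]
        simpa using hN
    · have h1 := Nat.floor_le (a := x / r) (by positivity)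
      have h2 := Nat.lt_floor_add_one (x / r)
      rw [le_div_iff₀ hr] at h1
      rw [div_lt_iff₀ hr] at h2
      refine ⟨⌊x / r⌋₊, ?_, h1, h2.le⟩
      have : (⌊x / r⌋₊ : ℝ) < ⌈1 / r⌉₊ := by
        refine lt_of_mul_lt_mul_right ?_ hr.le
        linarith
      exact_mod_cast this
  obtain ⟨i, hi, hi1, hi2⟩ := key
  refine Set.mem_iUnion₂.2 ⟨(i + 1 / 2 : ℝ) * r,
    Finset.mem_image.2 ⟨i, Finset.mem_range.2 hi, rfl⟩, ?_⟩
  rw [Metric.mem_closedBall, Real.dist_eq, abs_le]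
  constructor <;> linarith

theorem coverNum_le {F : Set ℝ} (hF : F ⊆ Set.Icc 0 1) {r : ℝ} (hr : 0 < r) :
    coverNum F r ≤ ⌈1 / r⌉₊ := by
  obtain ⟨s, hs, hFs⟩ := exists_cover_card_le hF hr
  refine le_trans (Nat.sInf_le ?_) hs
  exact ⟨s, rfl, hFs⟩

theorem card_metCells_le_coverNum {F : Set ℝ} (hF : F ⊆ Set.Icc 0 1) {r : ℝ} (hr : 0 < r) {m : ℕ}
    (hm : 2 ^ m * r ≤ 1) : (metCells m F).card ≤ coverNum F r * 2 := by
  obtain ⟨s, -, hFs⟩ := exists_cover_card_le hF hr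
  obtain ⟨s', hs', hFs'⟩ := Nat.sInf_mem
    (s := {n : ℕ | ∃ s : Finset ℝ, s.card = n ∧ F ⊆ ⋃ x ∈ s, Metric.closedBall x (r / 2)})
    ⟨_, s, rfl, hFs⟩
  rw [coverNum, ← hs']
  exact card_metCells_le hm hFs'

/-- A set in the unit interval meeting `2 ^ (m - o(m))` of the dyadic intervals of length
`2 ^ (-m)` has lower box dimension one. -/
theorem lowerBoxDim_eq_one_of_metCells {F : Set ℝ} (hF : F ⊆ Set.Icc 0 1) (hne : F.Nonempty)
    {w : ℕ → ℝ} {C : ℝ} (hw : Tendsto w atTop (nhds (Real.log 2)))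
    (h : ∀ᶠ m : ℕ in atTop, m * w m - C ≤ Real.log (metCells m F).card) :
    lowerBoxDim F = 1 := by
  have hlog2 : 0 < Real.log 2 := Real.log_pos (by norm_num)
  have hy : Tendsto (fun r : ℝ => -Real.log r / Real.log 2) (nhdsWithin 0 (Set.Ioi 0)) atTop :=
    (tendsto_neg_atBot_atTop.comp Real.tendsto_log_nhdsGT_zero).atTop_div_const hlog2
  have hfl : Tendsto (fun y : ℝ => (⌊y⌋₊ : ℝ) / y * (w ⌊y⌋₊ / Real.log 2)
      - (C / Real.log 2 + 1) / y) atTop (nhds 1) := by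
    have h1 := (tendsto_nat_floor_div_atTop (R := ℝ)).mul
      ((hw.comp (tendsto_nat_floor_atTop (α := ℝ))).div_const (Real.log 2))
    have h2 : Tendsto (fun y : ℝ => (C / Real.log 2 + 1) / y) atTop (nhds 0) :=
      tendsto_const_nhds.div_atTop tendsto_id
    have h3 := h1.sub h2
    rw [div_self hlog2.ne', mul_one, sub_zero] at h3
    exact h3
  have hup : Tendsto (fun y : ℝ => 1 + 1 / y) atTop (nhds 1) := by
    have : Tendsto (fun y : ℝ => 1 / y) atTop (nhds 0) :=
      tendsto_const_nhds.div_atTop tendsto_id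
    simpa using this.const_add 1
  have hr1 : ∀ᶠ r : ℝ in nhdsWithin 0 (Set.Ioi 0), r < 1 :=
    Filter.Eventually.filter_mono nhdsWithin_le_nhds (gt_mem_nhds one_pos)
  refine Tendsto.liminf_eq (tendsto_of_tendsto_of_tendsto_of_le_of_le' (hfl.comp hy) (hup.comp hy)
    ?_ ?_)
  · filter_upwards [hr1, self_mem_nhdsWithin,
      hy.eventually ((tendsto_nat_floor_atTop (α := ℝ)).eventually h)] with r hr1 hr0 hm
    have hr0 : 0 < r := hr0
    have hlogr : Real.log r < 0 := Real.log_neg hr0 hr1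
    simp only [Function.comp_apply]
    set y := -Real.log r / Real.log 2 with hydef
    have hy0 : 0 < y := div_pos (by linarith) hlog2
    have hlr : -Real.log r = y * Real.log 2 := by rw [hydef]; field_simp
    have hpow : 2 ^ ⌊y⌋₊ * r ≤ 1 := by
      rw [← Real.log_nonpos_iff (by positivity), Real.log_mul (by positivity) hr0.ne',
        Real.log_pow]
      have := mul_le_mul_of_nonneg_right (Nat.floor_le hy0.le) hlog2.le
      linarith
    have hcard := card_metCells_le_coverNum hF hr0 hpow
    have hcpos : 0 < (metCells ⌊y⌋₊ F).card := by
      obtain ⟨x, hx⟩ := hne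
      exact Finset.card_pos.2 ⟨_, mem_metCells hx⟩
    have hNpos : 0 < coverNum F r := by omega
    have hlog : Real.log (metCells ⌊y⌋₊ F).card ≤ Real.log (coverNum F r) + Real.log 2 := by
      rw [← Real.log_mul (Nat.cast_ne_zero.2 hNpos.ne') (by norm_num)]
      exact Real.log_le_log (Nat.cast_pos.2 hcpos) (by exact_mod_cast hcard)
    have e : -Real.log (coverNum F r) / Real.log r =
        Real.log (coverNum F r) / (y * Real.log 2) := by
      rw [← hlr, neg_div, div_neg]
    rw [e, le_div_iff₀ (by positivity)]
    have e2 : ((⌊y⌋₊ : ℝ) / y * (w ⌊y⌋₊ / Real.log 2) - (C / Real.log 2 + 1) / y) *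
        (y * Real.log 2) = ⌊y⌋₊ * w ⌊y⌋₊ - C - Real.log 2 := by
      field_simp
      ring
    rw [e2]
    linarith
  · filter_upwards [hr1, self_mem_nhdsWithin] with r hr1 hr0
    have hr0 : 0 < r := hr0
    have hlogr : Real.log r < 0 := Real.log_neg hr0 hr1
    simp only [Function.comp_apply]
    have hN : (coverNum F r : ℝ) ≤ 2 / r := by
      have h1 : (coverNum F r : ℝ) ≤ ⌈1 / r⌉₊ := by exact_mod_cast coverNum_le hF hr0
      have h2 := Nat.ceil_lt_add_one (a := 1 / r) (by positivity)
      have h3 : 1 ≤ 1 / r := by rw [le_div_iff₀ hr0]; linarith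
      have h4 : 2 / r = 1 / r + 1 / r := by ring
      linarith
    have hlog : Real.log (coverNum F r) ≤ Real.log 2 - Real.log r := by
      rw [← Real.log_div (by norm_num) hr0.ne']
      rcases Nat.eq_zero_or_pos (coverNum F r) with h0 | h0
      · rw [h0, Nat.cast_zero, Real.log_zero]
        refine Real.log_nonneg ?_
        rw [le_div_iff₀ hr0]; linarith
      · exact Real.log_le_log (by exact_mod_cast h0) hN
    have e : 1 + 1 / (-Real.log r / Real.log 2) = (Real.log 2 - Real.log r) / -Real.log r := by
      have := hlogr.ne
      field_simp
      ring
    rw [e, neg_div, ← div_neg]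
    exact div_le_div_of_nonneg_right hlog (by linarith)

section Doubling

variable {M : (ℕ → ℝ) →ₗ[ℝ] ℝ}

/-- The entropy at scale `2 ^ (-m)` of the orbit of `d` under doubling. -/
noncomputable def doublingEntropy (M : (ℕ → ℝ) →ₗ[ℝ] ℝ) (d : ℝ) (m : ℕ) : ℝ :=
  meanEntropy M (fun n => dyadicCell m (2 ^ n * d))

theorem doubling_dyadicCell_determined (d : ℝ) {a b n n' : ℕ}
    (h₁ : dyadicCell a (2 ^ n * d) = dyadicCell a (2 ^ n' * d))
    (h₂ : dyadicCell b (2 ^ (n + a) * d) = dyadicCell b (2 ^ (n' + a) * d)) :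
    dyadicCell (a + b) (2 ^ n * d) = dyadicCell (a + b) (2 ^ n' * d) := by
  refine dyadicCell_add_eq_of_eq h₁ ?_
  rw [← mul_assoc, ← mul_assoc, ← pow_add, ← pow_add, add_comm a n, add_comm a n']
  exact h₂

theorem subadditive_doublingEntropy (hM : IsShiftMean M) (d : ℝ) :
    Subadditive (doublingEntropy M d) := by
  intro a b
  have h1 := hM.entropy_pair_le (fun n => dyadicCell a (2 ^ n * d))
    (fun n => dyadicCell b (2 ^ (n + a) * d))
  have h2 := hM.entropy_shift (fun n => dyadicCell b (2 ^ n * d)) a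
  have h3 : doublingEntropy M d (a + b) ≤ meanEntropy M
      (fun n => (dyadicCell a (2 ^ n * d), dyadicCell b (2 ^ (n + a) * d))) :=
    hM.entropy_le_of_determined fun n n' h => by
      simp only [Prod.mk.injEq] at h
      exact doubling_dyadicCell_determined d h.1 h.2
  rw [h2] at h1
  exact h3.trans h1

theorem bddBelow_doublingEntropy (hM : IsShiftMean M) (d : ℝ) :
    BddBelow (Set.range fun n : ℕ => doublingEntropy M d n / n) := by
  refine ⟨0, ?_⟩
  rintro _ ⟨n, rfl⟩
  exact div_nonneg (hM.entropy_nonneg _) (Nat.cast_nonneg n)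

theorem sum_pow_le_two_pow {k m q t : ℕ} (ht : t ≤ 2 ^ (m + q)) :
    ∑ i ∈ Finset.range (k + 1), t ^ i ≤ 2 ^ (k + 1 + (m + q) * k) := by
  calc ∑ i ∈ Finset.range (k + 1), t ^ i
      ≤ ∑ i ∈ Finset.range (k + 1), (2 ^ (m + q)) ^ k := by
        refine Finset.sum_le_sum fun i hi => ?_
        exact (Nat.pow_le_pow_left ht i).trans
          (Nat.pow_le_pow_right (by positivity) (Nat.lt_succ_iff.1 (Finset.mem_range.1 hi)))
    _ = (k + 1) * 2 ^ ((m + q) * k) := by simp [pow_mul]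
    _ ≤ 2 ^ (k + 1) * 2 ^ ((m + q) * k) := by
        gcongr
        exact Nat.lt_two_pow_self.le
    _ = 2 ^ (k + 1 + (m + q) * k) := by rw [← pow_add]

/-- The sequence `P` has zero entropy, so conditioning on it does not decrease the entropy rate of
the doubling orbit. -/
theorem entropy_rate_le_conditional (hM : IsShiftMean M) (d : ℝ) (P : Polynomial ℝ) {m : ℕ}
    (hm : 1 ≤ m) : (subadditive_doublingEntropy hM d).lim * m ≤
      meanEntropy M (fun n => (dyadicCell m (2 ^ n * d), dyadicCell m (P.eval (n : ℝ)))) -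
        meanEntropy M (fun n => dyadicCell m (P.eval (n : ℝ))) + Real.log 2 := by
  set k := P.natDegree
  set h := (subadditive_doublingEntropy hM d).lim
  set D := meanEntropy M (fun n => (dyadicCell m (2 ^ n * d), dyadicCell m (P.eval (n : ℝ)))) -
        meanEntropy M (fun n => dyadicCell m (P.eval (n : ℝ))) + Real.log 2
  have key : ∀ q : ℕ, h * m - D ≤ (k + 1) * (m + (k + 1 + (m + q) * k)) * Real.log 2 / 2 ^ q := by
    intro q
    have hml : ∀ l < 2 ^ q, m * l ≤ 2 ^ (m + q) := fun l hl => by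
      rw [pow_add]
      exact Nat.mul_le_mul Nat.lt_two_pow_self.le hl.le
    have h1 := hM.entropy_blocks_le (fun L n => dyadicCell (m * L) (2 ^ n * d))
      (fun n => dyadicCell m (2 ^ n * d)) (fun n => dyadicCell m (P.eval (n : ℝ)))
      (taylorCells k (m + (k + 1 + (m + q) * k)) P) (fun l => m * l)
      (fun n n' => by rw [dyadicCell_eq_iff]; simp)
      (fun L n n' e1 e2 => doubling_dyadicCell_determined d e1 e2) (2 ^ q)
      (fun l hl => exists_bool_determining_dyadicCell le_rfl (sum_pow_le_two_pow (hml l hl)))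
    have h2 : doublingEntropy M d (m * 2 ^ q) ≤ meanEntropy M (fun n =>
        (dyadicCell (m * 2 ^ q) (2 ^ n * d),
          taylorCells k (m + (k + 1 + (m + q) * k)) P n)) :=
      hM.entropy_le_of_determined fun n n' e => (Prod.mk.inj e).1
    have h3 := (subadditive_doublingEntropy hM d).lim_le_div (bddBelow_doublingEntropy hM d)
      (n := m * 2 ^ q) (by positivity)
    rw [le_div_iff₀ (by positivity)] at h3
    have h4 := hM.entropy_le_log_card (X := taylorCells k (m + (k + 1 + (m + q) * k)) P)
      (s := Finset.univ) (fun n => Finset.mem_univ _)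
    rw [Finset.card_univ, Fintype.card_fun, Fintype.card_fin, ZMod.card] at h4
    push_cast at h1 h3 h4
    rw [Real.log_pow, Real.log_pow] at h4
    push_cast at h4
    rw [le_div_iff₀ (by positivity)]
    change h * _ ≤ _ at h3
    change _ ≤ _ + 2 ^ q * D at h1
    linarith
  have hlim : Tendsto (fun q : ℕ =>
      ((k : ℝ) + 1) * (m + (k + 1 + (m + q) * k)) * Real.log 2 / 2 ^ q) atTop (nhds 0) := by
    have t0 := tendsto_pow_const_div_const_pow_of_one_lt 0 (r := (2 : ℝ)) (by norm_num)
    have t1 := tendsto_pow_const_div_const_pow_of_one_lt 1 (r := (2 : ℝ)) (by norm_num)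
    have t2 := (t0.const_mul (((k : ℝ) + 1) * (m + (k + 1 + m * k)) * Real.log 2)).add
      (t1.const_mul (((k : ℝ) + 1) * k * Real.log 2))
    simp only [mul_zero, add_zero] at t2
    refine t2.congr fun q => ?_
    ring
  have := ge_of_tendsto' hlim key
  linarith

/-- The entropy of the sum of the polynomial sequence and the doubling orbit. -/
theorem le_entropy_poly_add_doubling (hM : IsShiftMean M) (d : ℝ) {j : ℕ} {P : Polynomial ℝ}
    (hP : HasTopIrrationalCoeff (j + 1) P) {m : ℕ} (hm : 3 ≤ m) :
    m * (Real.log 2 + (subadditive_doublingEntropy hM d).lim - doublingEntropy M d m / m) -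
      7 * Real.log 2 ≤ meanEntropy M (fun n => dyadicCell m (P.eval (n : ℝ) + 2 ^ n * d)) := by
  classical
  set A := fun n : ℕ => dyadicCell m (P.eval (n : ℝ))
  set B := fun n : ℕ => dyadicCell m (2 ^ n * d)
  set G := fun n : ℕ => dyadicCell m (P.eval (n : ℝ) + 2 ^ n * d)
  set E : ℕ → Bool := fun n => decide (G n = A n + B n)
  have hG : ∀ n, G n = A n + B n ∨ G n = A n + B n + 1 := fun n => dyadicCell_add m _ _
  have h1 : meanEntropy M (fun n => (B n, A n)) ≤ meanEntropy M (fun n => (G n, B n, E n)) :=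
    hM.entropy_le_of_determined fun n n' h => by
      simp only [Prod.mk.injEq] at h ⊢
      obtain ⟨hg, hb, he⟩ := h
      refine ⟨hb, ?_⟩
      have he' := decide_eq_decide.1 he
      by_cases h0 : G n = A n + B n
      · have h0' := he'.1 h0
        rw [hg, h0', hb] at h0
        exact (add_right_cancel h0).symm
      · have h0' := (hG n').resolve_left fun h' => h0 (he'.2 h')
        have h0 := (hG n).resolve_left h0
        rw [hg, h0', hb] at h0
        exact (add_right_cancel (add_right_cancel h0)).symm
  have h2 := hM.entropy_pair_le G (fun n => (B n, E n))
  have h3 := hM.entropy_pair_le B E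
  have h4 := hM.entropy_bool_le E
  have h5 := entropy_rate_le_conditional hM d P (m := m) (by omega)
  have h6 := hP.le_entropy_dyadicCell hM hm
  have hB : meanEntropy M B = m * (doublingEntropy M d m / m) := by
    have : (m : ℝ) ≠ 0 := by positivity
    field_simp
    rfl
  change _ ≤ meanEntropy M (fun n => (B n, A n)) - meanEntropy M A + _ at h5
  change _ ≤ meanEntropy M A at h6
  rw [mul_sub, mul_add, ← hB]
  linarith

end Doubling

/-- Let `p(n) = ∑_{i=0}^k a_i n^i` have at least one irrational coefficient
among the non-constant terms, and let `d` be any real. Then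
`{frac (p(n) + 2^n d) : n ≥ 1}` has lower box dimension `1`. -/
theorem lowerBoxDim_fract_poly_plus_doubling (k : ℕ) (a : ℕ → ℝ)
    (hirr : ∃ i, 1 ≤ i ∧ i ≤ k ∧ Irrational (a i)) (d : ℝ) :
    lowerBoxDim {x : ℝ | ∃ n : ℕ, 1 ≤ n ∧
      x = Int.fract ((∑ i ∈ Finset.range (k + 1), a i * (n : ℝ) ^ i) + 2 ^ n * d)} = 1 := by
  set F := {x : ℝ | ∃ n : ℕ, 1 ≤ n ∧
      x = Int.fract ((∑ i ∈ Finset.range (k + 1), a i * (n : ℝ) ^ i) + 2 ^ n * d)}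
  set P : Polynomial ℝ :=
    ∑ i ∈ Finset.range (k + 1), Polynomial.C (a i) * Polynomial.X ^ i with hPdef
  have heval : ∀ x : ℝ, P.eval x = ∑ i ∈ Finset.range (k + 1), a i * x ^ i := fun x => by
    simp [hPdef, Polynomial.eval_finsetSum]
  obtain ⟨j, hj⟩ : ∃ j, HasTopIrrationalCoeff (j + 1) P := by
    obtain ⟨i, hi1, hik, hi⟩ := hirr
    refine exists_hasTopIrrationalCoeff ⟨i, hi1, ?_⟩
    have : P.coeff i = a i := by
      simp [hPdef, Polynomial.finsetSum_coeff, Polynomial.coeff_C_mul, Polynomial.coeff_X_pow]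
      omega
    rwa [this]
  obtain ⟨M, hM⟩ := exists_isShiftMean
  have hF : F ⊆ Set.Icc 0 1 := by
    rintro _ ⟨n, -, rfl⟩
    exact ⟨Int.fract_nonneg _, (Int.fract_lt_one _).le⟩
  have hw : Tendsto (fun m : ℕ => Real.log 2 + (subadditive_doublingEntropy hM d).lim -
      doublingEntropy M d m / m) atTop (nhds (Real.log 2)) := by
    have := ((subadditive_doublingEntropy hM d).tendsto_lim
      (bddBelow_doublingEntropy hM d)).const_sub
      (Real.log 2 + (subadditive_doublingEntropy hM d).lim)
    rwa [add_sub_cancel_right] at this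
  refine lowerBoxDim_eq_one_of_metCells hF ⟨_, 1, le_rfl, rfl⟩ hw (C := 7 * Real.log 2) ?_
  filter_upwards [eventually_ge_atTop 3] with m hm
  refine (le_entropy_poly_add_doubling hM d hj hm).trans ?_
  rw [← hM.entropy_shift _ 1]
  refine hM.entropy_le_log_card fun n => ?_
  rw [← dyadicCell_fract]
  exact mem_metCells ⟨n + 1, by omega, by rw [heval]⟩
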